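/- arXiv:2102.00470 — 3 statements merged into one kernel-verified Lean document; each statement's English description precedes it below -/
import Mathlib

section
/- Let F be a Finsler metric on the 2-torus, v ∈ ℤ² a prime vector, and L̃(t, x, r) = F(tv + x·v⊥, v + r·v⊥) the associated time-periodic Lagrangian. Let θ : ℝ → ℝ be a smooth function and define γ : ℝ → ℝ² by γ(t) = tv + θ(t)·v⊥. Then γ is a reparametrization of an F-geodesic (i.e. there exist a C² strictly increasing bijection σ : ℝ → ℝ and an F-geodesic c with γ = c ∘ σ) if and only if θ is an Euler–Lagrange solution of L̃. -/
open Filter Topology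

noncomputable section

abbrev V2 : Type := ℝ × ℝ

def dot (p q : V2) : ℝ := p.1 * q.1 + p.2 * q.2

def latt (z : ℤ × ℤ) : V2 := ((z.1 : ℝ), (z.2 : ℝ))

def LF (F : V2 → V2 → ℝ) (x y : V2) : ℝ := (1/2) * (F x y)^2

def IsFinsler (F : V2 → V2 → ℝ) : Prop :=
  ContDiffOn ℝ (⊤ : ℕ∞) (fun p : V2 × V2 => F p.1 p.2) {p : V2 × V2 | p.2 ≠ 0} ∧
  (∀ (x y : V2) (z : ℤ × ℤ), F (x + latt z) y = F x y) ∧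
  (∀ (x y : V2) (lam : ℝ), 0 < lam → F x (lam • y) = lam * F x y) ∧
  (∀ x y, y ≠ 0 → 0 < F x y) ∧
  (∀ x y, y ≠ 0 → ∀ w, w ≠ (0 : V2) → 0 < fderiv ℝ (fderiv ℝ (LF F x)) y w w)

def IsGeodesic (F : V2 → V2 → ℝ) (c : ℝ → V2) : Prop :=
  ContDiff ℝ 2 c ∧ (∀ t, deriv c t ≠ 0) ∧
  ∀ t, HasDerivAt (fun s => fderiv ℝ (LF F (c s)) (deriv c s))
        (fderiv ℝ (fun x => LF F x (deriv c t)) (c t)) t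

def IsUnitSpeed (F : V2 → V2 → ℝ) (c : ℝ → V2) : Prop :=
  ∀ t, F (c t) (deriv c t) = 1

def vR (v : ℤ × ℤ) : V2 := ((v.1 : ℝ), (v.2 : ℝ))

def vPerp (v : ℤ × ℤ) : V2 := (-(v.2 : ℝ), (v.1 : ℝ))

def Ltilde (F : V2 → V2 → ℝ) (v : ℤ × ℤ) (t x r : ℝ) : ℝ :=
  F (t • vR v + x • vPerp v) (vR v + r • vPerp v)

def IsELSolution (L : ℝ → ℝ → ℝ → ℝ) (θ : ℝ → ℝ) : Prop :=
  ContDiff ℝ 2 θ ∧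
  ∀ t, HasDerivAt (fun s => deriv (fun r => L s (θ s) r) (deriv θ s))
        (deriv (fun x => L t x (deriv θ t)) (θ t)) t

def ELComplete (L : ℝ → ℝ → ℝ → ℝ) : Prop :=
  ∀ a b h : ℝ, ∃ θ : ℝ → ℝ, IsELSolution L θ ∧ θ a = b ∧ deriv θ a = h

def IsInvariantTorusFun (F : V2 → V2 → ℝ) (Y : V2 → V2) : Prop :=
  Continuous Y ∧ (∀ (x : V2) (z : ℤ × ℤ), Y (x + latt z) = Y x) ∧
  (∀ x, F x (Y x) = 1) ∧
  (∀ c : ℝ → V2, IsGeodesic F c → IsUnitSpeed F c → deriv c 0 = Y (c 0) →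
    ∀ t, deriv c t = Y (c t))

def IsInvariantTorus (F : V2 → V2 → ℝ) (Λ : Set (V2 × V2)) : Prop :=
  ∃ Y : V2 → V2, IsInvariantTorusFun F Y ∧ Λ = {p : V2 × V2 | p.2 = Y p.1}

def HasClosedGeodesic (F : V2 → V2 → ℝ) (Λ : Set (V2 × V2)) : Prop :=
  ∃ c : ℝ → V2, IsGeodesic F c ∧ IsUnitSpeed F c ∧ (c 0, deriv c 0) ∈ Λ ∧
    ∃ T > (0:ℝ), ∃ z : ℤ × ℤ, ∀ t, c (t + T) = c t + latt z

def BoundedDirection (F : V2 → V2 → ℝ) (Λ : Set (V2 × V2)) (v : ℤ × ℤ) : Prop :=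
  ∀ c : ℝ → V2, IsGeodesic F c → IsUnitSpeed F c → (c 0, deriv c 0) ∈ Λ →
    StrictMono (fun t => dot (c t) (vR v)) ∧
    Function.Surjective (fun t => dot (c t) (vR v))

/-- The horizontal (position) derivative of `F` at `(x, y)`. -/
def dPos (F : V2 → V2 → ℝ) (x y : V2) : V2 →L[ℝ] ℝ := fderiv ℝ (fun x' => F x' y) x

/-- The vertical (velocity) derivative of `F` at `(x, y)`. -/
def dVel (F : V2 → V2 → ℝ) (x y : V2) : V2 →L[ℝ] ℝ := fderiv ℝ (F x) y

/-- The Euler–Lagrange equation of the length functional along `c`. -/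
def IsLengthExtremal (F : V2 → V2 → ℝ) (c : ℝ → V2) : Prop :=
  ∀ t, HasDerivAt (fun s => dVel F (c s) (deriv c s)) (dPos F (c t) (deriv c t)) t

theorem isOpen_snd_ne_zero : IsOpen {p : V2 × V2 | p.2 ≠ 0} :=
  isOpen_ne_fun continuous_snd continuous_const

namespace IsFinsler

variable {F : V2 → V2 → ℝ}

theorem contDiffAt (hF : IsFinsler F) {p : V2 × V2} (hp : p.2 ≠ 0) :
    ContDiffAt ℝ (⊤ : ℕ∞) (fun p : V2 × V2 => F p.1 p.2) p :=
  hF.1.contDiffAt (isOpen_snd_ne_zero.mem_nhds hp)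

theorem pos (hF : IsFinsler F) {x y : V2} (hy : y ≠ 0) : 0 < F x y := hF.2.2.2.1 x y hy

theorem smul (hF : IsFinsler F) (x y : V2) {r : ℝ} (hr : 0 < r) : F x (r • y) = r * F x y :=
  hF.2.2.1 x y r hr

theorem differentiableAt (hF : IsFinsler F) {p : V2 × V2} (hp : p.2 ≠ 0) :
    DifferentiableAt ℝ (fun p : V2 × V2 => F p.1 p.2) p :=
  (hF.contDiffAt hp).differentiableAt (by simp)

theorem hasFDerivAt_vel_comp (hF : IsFinsler F) (x : V2) {y : V2} (hy : y ≠ 0) :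
    HasFDerivAt (F x)
      ((fderiv ℝ (fun p : V2 × V2 => F p.1 p.2) (x, y)).comp (.inr ℝ V2 V2)) y :=
  HasFDerivAt.comp (g := fun p : V2 × V2 => F p.1 p.2) y
    (hF.differentiableAt (p := (x, y)) hy).hasFDerivAt (hasFDerivAt_prodMk_right x y)

theorem hasFDerivAt_pos_comp (hF : IsFinsler F) (x : V2) {y : V2} (hy : y ≠ 0) :
    HasFDerivAt (fun x' => F x' y)
      ((fderiv ℝ (fun p : V2 × V2 => F p.1 p.2) (x, y)).comp (.inl ℝ V2 V2)) x :=
  HasFDerivAt.comp (g := fun p : V2 × V2 => F p.1 p.2) (f := fun x' => (x', y)) x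
    (hF.differentiableAt (p := (x, y)) hy).hasFDerivAt (hasFDerivAt_prodMk_left x y)

theorem hasFDerivAt_vel (hF : IsFinsler F) (x : V2) {y : V2} (hy : y ≠ 0) :
    HasFDerivAt (F x) (dVel F x y) y :=
  (hF.hasFDerivAt_vel_comp x hy).differentiableAt.hasFDerivAt

theorem hasFDerivAt_pos (hF : IsFinsler F) (x : V2) {y : V2} (hy : y ≠ 0) :
    HasFDerivAt (fun x' => F x' y) (dPos F x y) x :=
  (hF.hasFDerivAt_pos_comp x hy).differentiableAt.hasFDerivAt

theorem differentiableAt_dVel (hF : IsFinsler F) {p : V2 × V2} (hp : p.2 ≠ 0) :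
    DifferentiableAt ℝ (fun p : V2 × V2 => dVel F p.1 p.2) p := by
  have h : DifferentiableAt ℝ (fderiv ℝ (fun p : V2 × V2 => F p.1 p.2)) p :=
    ((hF.contDiffAt hp).fderiv_right (m := 1) (by norm_cast)).differentiableAt (by simp)
  refine (h.clm_comp
    (differentiableAt_const (ContinuousLinearMap.inr ℝ V2 V2))).congr_of_eventuallyEq ?_
  filter_upwards [isOpen_snd_ne_zero.mem_nhds hp] with q hq
  exact (hF.hasFDerivAt_vel_comp q.1 hq).fderiv

theorem dVel_self (hF : IsFinsler F) (x : V2) {y : V2} (hy : y ≠ 0) :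
    dVel F x y y = F x y := by
  have h1 : HasDerivAt (fun r : ℝ => r • y) y 1 := by
    simpa using (hasDerivAt_id (1 : ℝ)).smul_const y
  have h2 : HasDerivAt (fun r : ℝ => F x (r • y)) (dVel F x y y) 1 :=
    HasFDerivAt.comp_hasDerivAt (l := F x) (1 : ℝ)
      (by simpa using hF.hasFDerivAt_vel x hy) h1
  have h3 : HasDerivAt (fun r : ℝ => F x (r • y)) (F x y) 1 := by
    have : HasDerivAt (fun r : ℝ => r * F x y) (F x y) 1 := by
      simpa using (hasDerivAt_id (1 : ℝ)).mul_const (F x y)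
    refine this.congr_of_eventuallyEq ?_
    filter_upwards [lt_mem_nhds (zero_lt_one' ℝ)] with r hr
    exact hF.smul x y hr
  exact h2.unique h3

theorem dVel_smul (hF : IsFinsler F) (x : V2) {y : V2} (hy : y ≠ 0) {r : ℝ} (hr : 0 < r) :
    dVel F x (r • y) = dVel F x y := by
  have h1 : HasFDerivAt (fun z : V2 => F x (r • z))
      ((dVel F x (r • y)).comp (r • ContinuousLinearMap.id ℝ V2)) y :=
    HasFDerivAt.comp (g := F x) y (hF.hasFDerivAt_vel x (smul_ne_zero hr.ne' hy))
      ((hasFDerivAt_id y).const_smul r)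
  have h2 : HasFDerivAt (fun z : V2 => F x (r • z)) (r • dVel F x y) y := by
    have h : (fun z : V2 => F x (r • z)) = fun z => r • F x z := by
      funext z
      exact hF.smul x z hr
    rw [h]
    exact (hF.hasFDerivAt_vel x hy).const_smul r
  have h3 := h1.unique h2
  rw [ContinuousLinearMap.comp_smul, ContinuousLinearMap.comp_id] at h3
  exact smul_right_injective _ hr.ne' h3

theorem dPos_smul (hF : IsFinsler F) (x : V2) {y : V2} (hy : y ≠ 0) {r : ℝ} (hr : 0 < r) :
    dPos F x (r • y) = r • dPos F x y := by
  have h : (fun x' => F x' (r • y)) = fun x' => r • F x' y := by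
    funext x'
    exact hF.smul x' y hr
  unfold dPos
  rw [h]
  exact ((hF.hasFDerivAt_pos x hy).const_smul r).fderiv

theorem fderiv_LF_vel (hF : IsFinsler F) (x : V2) {y : V2} (hy : y ≠ 0) :
    fderiv ℝ (LF F x) y = F x y • dVel F x y := by
  have h := ((hF.hasFDerivAt_vel x hy).pow 2).const_mul (1 / 2)
  refine (h.congr_fderiv ?_).fderiv
  ext <;> simp <;> ring

theorem fderiv_LF_pos (hF : IsFinsler F) (x : V2) {y : V2} (hy : y ≠ 0) :
    fderiv ℝ (fun x' => LF F x' y) x = F x y • dPos F x y := by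
  have h := ((hF.hasFDerivAt_pos x hy).pow 2).const_mul (1 / 2)
  refine (h.congr_fderiv ?_).fderiv
  ext <;> simp <;> ring

theorem hasDerivAt_comp (hF : IsFinsler F) {x y : ℝ → V2} {x' y' : V2} {t : ℝ}
    (hx : HasDerivAt x x' t) (hy : HasDerivAt y y' t) (h0 : y t ≠ 0) :
    HasDerivAt (fun s => F (x s) (y s)) (dPos F (x t) (y t) x' + dVel F (x t) (y t) y') t := by
  have h := HasFDerivAt.comp_hasDerivAt (l := fun p : V2 × V2 => F p.1 p.2) t
    (hF.differentiableAt (p := (x t, y t)) h0).hasFDerivAt (hx.prodMk hy)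
  refine h.congr_deriv ?_
  rw [show dPos F (x t) (y t) = _ from (hF.hasFDerivAt_pos_comp (x t) h0).fderiv,
    show dVel F (x t) (y t) = _ from (hF.hasFDerivAt_vel_comp (x t) h0).fderiv]
  simp [← map_add]

/-- Along any regular curve the Euler–Lagrange expression annihilates the velocity. -/
theorem apply_velocity_of_hasDerivAt_dVel (hF : IsFinsler F) {x y : ℝ → V2} {y' : V2} {t : ℝ}
    {A : V2 →L[ℝ] ℝ} (hx : HasDerivAt x (y t) t) (hy : HasDerivAt y y' t) (h0 : ∀ s, y s ≠ 0)
    (hA : HasDerivAt (fun s => dVel F (x s) (y s)) A t) :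
    A (y t) = dPos F (x t) (y t) (y t) := by
  have h1 := hF.hasDerivAt_comp hx hy (h0 t)
  have h2 := hA.clm_apply hy
  simp only [hF.dVel_self _ (h0 _)] at h2
  linarith [h1.unique h2]

theorem differentiableAt_dVel_comp (hF : IsFinsler F) {x y : ℝ → V2} {t : ℝ}
    (hx : DifferentiableAt ℝ x t) (hy : DifferentiableAt ℝ y t) (h0 : y t ≠ 0) :
    DifferentiableAt ℝ (fun s => dVel F (x s) (y s)) t :=
  DifferentiableAt.comp (g := fun p : V2 × V2 => dVel F p.1 p.2) t
    (hF.differentiableAt_dVel (p := (x t, y t)) h0) (hx.prodMk hy)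

end IsFinsler

theorem ContDiff.hasDerivAt_two {E : Type*} [NormedAddCommGroup E] [NormedSpace ℝ E]
    {c : ℝ → E} (hc : ContDiff ℝ 2 c) (t : ℝ) :
    HasDerivAt c (deriv c t) t ∧ HasDerivAt (deriv c) (deriv (deriv c) t) t :=
  ⟨(hc.differentiable (by simp) t).hasDerivAt,
    (hc.differentiable_deriv_two t).hasDerivAt⟩

theorem IsGeodesic.isLengthExtremal {F : V2 → V2 → ℝ} (hF : IsFinsler F) {c : ℝ → V2}
    (hc : IsGeodesic F c) : IsLengthExtremal F c := by
  obtain ⟨h2, h0, hEL⟩ := hc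
  have hx := fun t => (h2.hasDerivAt_two t).1
  have hy := fun t => (h2.hasDerivAt_two t).2
  intro t
  have hEL := hEL t
  simp only [hF.fderiv_LF_vel _ (h0 _), hF.fderiv_LF_pos _ (h0 _)] at hEL
  have hA := (hF.differentiableAt_dVel_comp (hx t).differentiableAt (hy t).differentiableAt
    (h0 t)).hasDerivAt
  have hE := hF.apply_velocity_of_hasDerivAt_dVel (hx t) (hy t) h0 hA
  have hφ := hF.hasDerivAt_comp (hx t) (hy t) (h0 t)
  have hU := (hφ.smul hA).unique hEL
  have hp := hF.pos (x := c t) (h0 t)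
  have hV := congrArg (fun f : V2 →L[ℝ] ℝ => f (deriv c t)) hU
  simp only [add_apply, smul_apply, smul_eq_mul, hE,
    hF.dVel_self _ (h0 t)] at hV
  have hφ0 : dPos F (c t) (deriv c t) (deriv c t)
      + dVel F (c t) (deriv c t) (deriv (deriv c) t) = 0 := by
    have := add_eq_left.1 hV
    exact (mul_eq_zero.1 this).resolve_right hp.ne'
  rw [hφ0, zero_smul, add_zero] at hU
  rw [smul_right_injective _ hp.ne' hU] at hA
  exact hA

theorem IsLengthExtremal.isGeodesic {F : V2 → V2 → ℝ} (hF : IsFinsler F) {c : ℝ → V2}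
    (hc : IsLengthExtremal F c) (h2 : ContDiff ℝ 2 c) (h0 : ∀ t, deriv c t ≠ 0)
    (hu : IsUnitSpeed F c) : IsGeodesic F c := by
  refine ⟨h2, h0, fun t => ?_⟩
  simp only [hF.fderiv_LF_vel _ (h0 _), hF.fderiv_LF_pos _ (h0 _), hu _, one_smul]
  exact hc t

theorem IsLengthExtremal.comp {F : V2 → V2 → ℝ} (hF : IsFinsler F) {c : ℝ → V2}
    (hc : IsLengthExtremal F c) (hd : Differentiable ℝ c) (h0 : ∀ t, deriv c t ≠ 0)
    {σ : ℝ → ℝ} (hσ : Differentiable ℝ σ) (hσ0 : ∀ t, 0 < deriv σ t) :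
    IsLengthExtremal F (c ∘ σ) := by
  have hder : ∀ t, deriv (c ∘ σ) t = deriv σ t • deriv c (σ t) := fun t =>
    ((hd (σ t)).hasDerivAt.scomp t (hσ t).hasDerivAt).deriv
  intro t
  have hVel : ∀ s, dVel F ((c ∘ σ) s) (deriv (c ∘ σ) s) = dVel F (c (σ s)) (deriv c (σ s)) :=
    fun s => by rw [hder, Function.comp_apply, hF.dVel_smul _ (h0 _) (hσ0 _)]
  rw [hder, hF.dPos_smul _ (h0 _) (hσ0 _)]
  simp only [hVel]
  exact (hc (σ t)).scomp t (hσ t).hasDerivAt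

section Graph

variable {v : ℤ × ℤ}

theorem vR_normSq_pos (hv : IsCoprime v.1 v.2) : 0 < (v.1 : ℝ) ^ 2 + (v.2 : ℝ) ^ 2 := by
  have h : v.1 ≠ 0 ∨ v.2 ≠ 0 := by
    by_contra! h
    rw [h.1, h.2] at hv
    exact not_isCoprime_zero_zero hv
  rcases h with h | h
  · have : (v.1 : ℝ) ≠ 0 := by exact_mod_cast h
    positivity
  · have : (v.2 : ℝ) ≠ 0 := by exact_mod_cast h
    positivity

theorem dot_add_smul_vPerp (r : ℝ) :
    dot (vR v + r • vPerp v) (vR v) = (v.1 : ℝ) ^ 2 + (v.2 : ℝ) ^ 2 := by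
  simp [dot, vR, vPerp]
  ring

theorem add_smul_vPerp_ne_zero (hv : IsCoprime v.1 v.2) (r : ℝ) : vR v + r • vPerp v ≠ 0 := by
  intro h
  have h1 := dot_add_smul_vPerp (v := v) r
  rw [h] at h1
  have := vR_normSq_pos hv
  simp [dot] at h1
  linarith

theorem clm_ext_frame (hv : IsCoprime v.1 v.2) (r : ℝ) {A B : V2 →L[ℝ] ℝ}
    (h1 : A (vR v + r • vPerp v) = B (vR v + r • vPerp v)) (h2 : A (vPerp v) = B (vPerp v)) :
    A = B := by
  have h3 : A (vR v) = B (vR v) := by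
    simpa [map_add, map_smul, h2] using h1
  have hn := vR_normSq_pos hv
  refine ContinuousLinearMap.ext fun w => ?_
  have hw : ((v.1 : ℝ) ^ 2 + (v.2 : ℝ) ^ 2) • w
      = (dot w (vR v)) • vR v + (dot w (vPerp v)) • vPerp v := by
    ext <;> simp [dot, vR, vPerp] <;> ring
  have h4 : A (((v.1 : ℝ) ^ 2 + (v.2 : ℝ) ^ 2) • w) = B (((v.1 : ℝ) ^ 2 + (v.2 : ℝ) ^ 2) • w) := by
    rw [hw]
    simp only [map_add, map_smul, h2, h3]
  simp only [map_smul] at h4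
  exact smul_right_injective _ hn.ne' h4

theorem hasDerivAt_graph {θ : ℝ → ℝ} {t : ℝ} (h : DifferentiableAt ℝ θ t) :
    HasDerivAt (fun t => t • vR v + θ t • vPerp v) (vR v + deriv θ t • vPerp v) t := by
  have h1 := ((hasDerivAt_id t).smul_const (vR v)).add (h.hasDerivAt.smul_const (vPerp v))
  rw [one_smul] at h1
  exact h1

theorem deriv_Ltilde_vel {F : V2 → V2 → ℝ} (hF : IsFinsler F) (hv : IsCoprime v.1 v.2)
    (t x r : ℝ) : deriv (fun r => Ltilde F v t x r) r
      = dVel F (t • vR v + x • vPerp v) (vR v + r • vPerp v) (vPerp v) := by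
  have h : HasDerivAt (fun r : ℝ => vR v + r • vPerp v) (vPerp v) r := by
    simpa using ((hasDerivAt_id r).smul_const (vPerp v)).const_add (vR v)
  exact ((hF.hasFDerivAt_vel _ (add_smul_vPerp_ne_zero hv r)).comp_hasDerivAt r h).deriv

theorem deriv_Ltilde_pos {F : V2 → V2 → ℝ} (hF : IsFinsler F) (hv : IsCoprime v.1 v.2)
    (t x r : ℝ) : deriv (fun x => Ltilde F v t x r) x
      = dPos F (t • vR v + x • vPerp v) (vR v + r • vPerp v) (vPerp v) := by
  have h : HasDerivAt (fun x : ℝ => t • vR v + x • vPerp v) (vPerp v) x := by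
    simpa using ((hasDerivAt_id x).smul_const (vPerp v)).const_add (t • vR v)
  exact ((hF.hasFDerivAt_pos _ (add_smul_vPerp_ne_zero hv r)).comp_hasDerivAt x h).deriv

theorem isELSolution_iff_isLengthExtremal {F : V2 → V2 → ℝ} (hF : IsFinsler F)
    (hv : IsCoprime v.1 v.2) {θ : ℝ → ℝ} (hθ : ContDiff ℝ 2 θ) :
    IsELSolution (Ltilde F v) θ ↔ IsLengthExtremal F (fun t => t • vR v + θ t • vPerp v) := by
  have hx : ∀ t, HasDerivAt (fun t => t • vR v + θ t • vPerp v) (vR v + deriv θ t • vPerp v) t :=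
    fun t => hasDerivAt_graph (hθ.hasDerivAt_two t).1.differentiableAt
  have hy : ∀ t, HasDerivAt (fun t => vR v + deriv θ t • vPerp v)
      (deriv (deriv θ) t • vPerp v) t := fun t =>
    ((hθ.hasDerivAt_two t).2.smul_const (vPerp v)).const_add (vR v)
  have h0 : ∀ t, vR v + deriv θ t • vPerp v ≠ 0 := fun t => add_smul_vPerp_ne_zero hv _
  simp only [IsELSolution, IsLengthExtremal, deriv_Ltilde_vel hF hv, deriv_Ltilde_pos hF hv,
    (hx _).deriv]
  constructor
  · rintro ⟨-, h⟩ t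
    have hA := (hF.differentiableAt_dVel_comp (hx t).differentiableAt (hy t).differentiableAt
      (h0 t)).hasDerivAt
    have hE := hF.apply_velocity_of_hasDerivAt_dVel (hx t) (hy t) h0 hA
    have hP := (hA.clm_apply (hasDerivAt_const t (vPerp v))).unique (h t)
    rw [map_zero, add_zero] at hP
    rw [clm_ext_frame hv _ hE hP] at hA
    exact hA
  · intro h
    refine ⟨hθ, fun t => ?_⟩
    simpa using (h t).clm_apply (hasDerivAt_const t (vPerp v))

end Graph

theorem IsFinsler.exists_pos_mul_norm_le {F : V2 → V2 → ℝ} (hF : IsFinsler F) :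
    ∃ m > 0, ∀ x y : V2, y ≠ 0 → m * ‖y‖ ≤ F x y := by
  set K : Set (V2 × V2) := (Set.Icc 0 1 ×ˢ Set.Icc 0 1) ×ˢ Metric.sphere 0 1 with hK
  have hKc : IsCompact K := (isCompact_Icc.prod isCompact_Icc).prod (isCompact_sphere _ _)
  have hne : K.Nonempty := ⟨((0, 0), (1, 0)), by simp [hK, Prod.norm_def]⟩
  have hK0 : ∀ p ∈ K, p.2 ≠ 0 := by
    rintro p ⟨-, h⟩ h0
    rw [h0] at h
    simp at h
  obtain ⟨p, hp, hmin⟩ := hKc.exists_isMinOn hne (hF.1.continuousOn.mono hK0)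
  refine ⟨F p.1 p.2, hF.pos (hK0 p hp), fun x y hy => ?_⟩
  have hn : 0 < ‖y‖ := norm_pos_iff.2 hy
  have hx : F x y = F (Int.fract x.1, Int.fract x.2) y := by
    rw [← hF.2.1 (Int.fract x.1, Int.fract x.2) y (⌊x.1⌋, ⌊x.2⌋)]
    congr 1
    ext <;> simp [latt]
  have hy' : y = ‖y‖ • (‖y‖⁻¹ • y) := by rw [smul_inv_smul₀ hn.ne']
  have hq : ((Int.fract x.1, Int.fract x.2), ‖y‖⁻¹ • y) ∈ K := by
    refine ⟨⟨⟨Int.fract_nonneg _, (Int.fract_lt_one _).le⟩,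
      ⟨Int.fract_nonneg _, (Int.fract_lt_one _).le⟩⟩, ?_⟩
    simp only [mem_sphere_zero_iff_norm, norm_smul, norm_inv, norm_norm]
    exact inv_mul_cancel₀ hn.ne'
  have h1 : F p.1 p.2 ≤ F (Int.fract x.1, Int.fract x.2) (‖y‖⁻¹ • y) := hmin hq
  rw [hx, hy', hF.smul _ _ hn, ← hy', mul_comm]
  gcongr

theorem exists_pos_le_norm_add_smul_vPerp {v : ℤ × ℤ} (hv : IsCoprime v.1 v.2) :
    ∃ m > 0, ∀ r : ℝ, m ≤ ‖vR v + r • vPerp v‖ := by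
  have hn := vR_normSq_pos hv
  have hK : 0 < |(v.1 : ℝ)| + |(v.2 : ℝ)| := by
    by_contra! h
    have h3 := abs_nonneg (v.1 : ℝ)
    have h4 := abs_nonneg (v.2 : ℝ)
    have h1 : (v.1 : ℝ) = 0 := abs_eq_zero.1 (by linarith)
    have h2 : (v.2 : ℝ) = 0 := abs_eq_zero.1 (by linarith)
    simp [h1, h2] at hn
  refine ⟨_, div_pos hn hK, fun r => ?_⟩
  rw [div_le_iff₀ hK, ← dot_add_smul_vPerp r]
  generalize vR v + r • vPerp v = w
  have h1 : w.1 * v.1 ≤ ‖w‖ * |(v.1 : ℝ)| := (le_abs_self _).trans (by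
    rw [abs_mul]
    gcongr
    exact norm_fst_le w)
  have h2 : w.2 * v.2 ≤ ‖w‖ * |(v.2 : ℝ)| := (le_abs_self _).trans (by
    rw [abs_mul]
    gcongr
    exact norm_snd_le w)
  simp only [dot, vR]
  linarith

/-- A primitive of a positive `C¹` function bounded away from zero is a `C²` diffeomorphism
of the line. -/
theorem exists_primitive_inverse {φ : ℝ → ℝ} (hφ : ContDiff ℝ 1 φ) {m : ℝ} (hm : 0 < m)
    (hφm : ∀ t, m ≤ φ t) :
    ∃ σ τ : ℝ → ℝ, ContDiff ℝ 2 σ ∧ ContDiff ℝ 2 τ ∧ StrictMono σ ∧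
      Function.LeftInverse τ σ ∧ Function.RightInverse τ σ ∧
      ∀ s, HasDerivAt τ (φ (τ s))⁻¹ s := by
  set σ : ℝ → ℝ := fun t => ∫ s in (0 : ℝ)..t, φ s with hσ
  have hd : ∀ t, HasDerivAt σ (φ t) t := fun t =>
    (hφ.continuous.integral_hasStrictDerivAt 0 t).hasDerivAt
  have hderiv : deriv σ = φ := funext fun t => (hd t).deriv
  have hpos : ∀ t, 0 < φ t := fun t => hm.trans_le (hφm t)
  have hmono : StrictMono σ := strictMono_of_deriv_pos fun t => by rw [hderiv]; exact hpos t
  have hσ2 : ContDiff ℝ 2 σ := by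
    rw [show (2 : WithTop ℕ∞) = 1 + 1 by norm_num, contDiff_succ_iff_deriv]
    exact ⟨fun t => (hd t).differentiableAt, by simp, by rwa [hderiv]⟩
  have hmono' : Monotone (fun t => σ t - m * t) := by
    have hd' : ∀ t, HasDerivAt (fun t => σ t - m * t) (φ t - m * 1) t := fun t =>
      (hd t).sub ((hasDerivAt_id t).const_mul m)
    refine monotone_of_deriv_nonneg (fun t => (hd' t).differentiableAt) fun t => ?_
    rw [(hd' t).deriv]
    linarith [hφm t]
  have h00 : σ 0 = 0 := by simp [hσ]
  have htop : Tendsto σ atTop atTop := by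
    refine tendsto_atTop_mono' _ ?_ (tendsto_id.const_mul_atTop hm)
    filter_upwards [eventually_ge_atTop 0] with t ht
    have := hmono' ht
    simp only [h00] at this
    simp only [id]
    linarith
  have hbot : Tendsto σ atBot atBot := by
    refine tendsto_atBot_mono' _ ?_ (tendsto_id.const_mul_atBot hm)
    filter_upwards [eventually_le_atBot 0] with t ht
    have := hmono' ht
    simp only [h00] at this
    simp only [id]
    linarith
  have hsurj : Function.Surjective σ := hσ2.continuous.surjective htop hbot
  set e : ℝ ≃o ℝ := hmono.orderIsoOfSurjective σ hsurj
  have hl : Function.LeftInverse e.symm σ := fun t => e.symm_apply_apply t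
  have hr : Function.RightInverse e.symm σ := fun t => e.apply_symm_apply t
  have hτ : ∀ s, HasDerivAt e.symm (φ (e.symm s))⁻¹ s := fun s =>
    (hd (e.symm s)).of_local_left_inverse e.symm.continuous.continuousAt (hpos _).ne'
      (Eventually.of_forall hr)
  have hτd : deriv e.symm = fun s => (φ (e.symm s))⁻¹ := funext fun s => (hτ s).deriv
  have hτ1 : ContDiff ℝ 1 e.symm := by
    rw [contDiff_one_iff_deriv]
    refine ⟨fun s => (hτ s).differentiableAt, ?_⟩
    rw [hτd]
    exact (hφ.continuous.comp e.symm.continuous).inv₀ fun s => (hpos _).ne'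
  refine ⟨σ, e.symm, hσ2, ?_, hmono, hl, hr, hτ⟩
  rw [show (2 : WithTop ℕ∞) = 1 + 1 by norm_num, contDiff_succ_iff_deriv]
  refine ⟨fun s => (hτ s).differentiableAt, by simp, ?_⟩
  rw [hτd]
  exact (hφ.comp hτ1).inv fun s => (hpos _).ne'

/-- The curve `γ(t) = tv + θ(t)v⊥` is a reparametrization of an `F`-geodesic
iff `θ` is an Euler–Lagrange solution of the associated time-periodic Lagrangian `L̃`. -/
theorem reparam_geodesic_iff_euler_lagrange
    (F : V2 → V2 → ℝ) (hF : IsFinsler F)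
    (v : ℤ × ℤ) (hv : IsCoprime v.1 v.2)
    (θ : ℝ → ℝ) (hθ : ContDiff ℝ (⊤ : ℕ∞) θ) :
    (∃ σ : ℝ → ℝ, ContDiff ℝ 2 σ ∧ StrictMono σ ∧ Function.Bijective σ ∧
        ∃ c : ℝ → V2, IsGeodesic F c ∧
          (fun t => t • vR v + θ t • vPerp v) = c ∘ σ) ↔
      IsELSolution (Ltilde F v) θ := by
  have hθ2 : ContDiff ℝ 2 θ := hθ.of_le (by norm_cast)
  rw [isELSolution_iff_isLengthExtremal hF hv hθ2]
  have hx : ∀ t, HasDerivAt (fun t => t • vR v + θ t • vPerp v) (vR v + deriv θ t • vPerp v) t :=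
    fun t => hasDerivAt_graph (hθ2.hasDerivAt_two t).1.differentiableAt
  have h0 : ∀ t, vR v + deriv θ t • vPerp v ≠ 0 := fun t => add_smul_vPerp_ne_zero hv _
  constructor
  · rintro ⟨σ, hσ, hmono, -, c, hc, hγ⟩
    have hσd : Differentiable ℝ σ := hσ.differentiable (by simp)
    have hcd : Differentiable ℝ c := hc.1.differentiable (by simp)
    rw [hγ] at hx ⊢
    refine (hc.isLengthExtremal hF).comp hF hcd hc.2.1 hσd fun t => ?_
    refine lt_of_le_of_ne hmono.monotone.deriv_nonneg fun h => h0 t ?_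
    have h1 := (hcd (σ t)).hasDerivAt.scomp t (hσd t).hasDerivAt
    rw [(hx t).unique h1, ← h, zero_smul]
  · intro h
    have hγ2 : ContDiff ℝ 2 (fun t => t • vR v + θ t • vPerp v) := by fun_prop
    have hθ1 : ContDiff ℝ 1 (deriv θ) := by
      have := hθ2
      rw [show (2 : WithTop ℕ∞) = 1 + 1 by norm_num, contDiff_succ_iff_deriv] at this
      exact this.2.2
    have hφ : ContDiff ℝ 1
        (fun t => F (t • vR v + θ t • vPerp v) (vR v + deriv θ t • vPerp v)) := by
      rw [contDiff_iff_contDiffAt]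
      intro t
      refine ContDiffAt.comp (g := fun p : V2 × V2 => F p.1 p.2)
        (f := fun t => (t • vR v + θ t • vPerp v, vR v + deriv θ t • vPerp v)) t
        ((hF.contDiffAt (h0 t)).of_le (by norm_cast)) ?_
      exact ((hγ2.of_le (by norm_num)).prodMk (by fun_prop)).contDiffAt
    obtain ⟨m, hm, hmF⟩ := hF.exists_pos_mul_norm_le
    obtain ⟨k, hk, hkv⟩ := exists_pos_le_norm_add_smul_vPerp hv
    obtain ⟨σ, τ, hσ, hτ, hmono, hl, hr, hτd⟩ := exists_primitive_inverse hφ (mul_pos hm hk)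
      fun t => (mul_le_mul_of_nonneg_left (hkv _) hm.le).trans (hmF _ _ (h0 t))
    have hpos : ∀ t, 0 < F (t • vR v + θ t • vPerp v) (vR v + deriv θ t • vPerp v) :=
      fun t => hF.pos (h0 t)
    have hτpos : ∀ s, 0 < deriv τ s := fun s => by
      rw [(hτd s).deriv]
      exact inv_pos.2 (hpos _)
    have hcd : ∀ s, deriv ((fun t => t • vR v + θ t • vPerp v) ∘ τ) s
        = deriv τ s • (vR v + deriv θ (τ s) • vPerp v) := fun s =>
      ((hx (τ s)).scomp s (hτd s).differentiableAt.hasDerivAt).deriv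
    refine ⟨σ, hσ, hmono, ⟨hl.injective, hr.surjective⟩,
      (fun t => t • vR v + θ t • vPerp v) ∘ τ, ?_, ?_⟩
    · refine (h.comp hF (fun t => (hx t).differentiableAt) (fun t => ?_)
        (fun s => (hτd s).differentiableAt) hτpos).isGeodesic hF (hγ2.comp hτ) (fun s => ?_)
        fun s => ?_
      · rw [(hx t).deriv]
        exact h0 t
      · rw [hcd]
        exact smul_ne_zero (hτpos s).ne' (h0 _)
      · rw [hcd, hF.smul _ _ (hτpos s), (hτd s).deriv]
        exact inv_mul_cancel₀ (hpos _).ne'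
    · funext t
      simp only [Function.comp_apply, hl t]
end
end

section
/- Let F : ℝ² × ℝ² → ℝ be smooth on ℝ² × (ℝ² \ {0}) with F(x, λy) = λF(x, y) for all λ > 0 (positive homogeneity). Let γ : [a, b] → ℝ² be C² with γ'(t) ≠ 0 for all t, and let λ : [a, b] → ℝ be C¹ with λ(a) = λ(b) = 0. Then the first variation of the F-length of γ in the tangential direction A(t) = λ(t)γ'(t) vanishes: ∫ₐᵇ [ ∂_x F(γ(t), γ'(t))[A(t)] + ∂_y F(γ(t), γ'(t))[A'(t)] ] dt = 0, where ∂_x F and ∂_y F denote the partial Fréchet derivatives of F in the first and second ℝ²-variable. -/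
open Filter Topology

noncomputable section

/-- Euler's identity for a positively homogeneous function of degree one. -/
theorem HasFDerivAt.apply_self_of_pos_homogeneous {E : Type*} [NormedAddCommGroup E]
    [NormedSpace ℝ E] {f : E → ℝ} {f' : E →L[ℝ] ℝ} {y : E} (hf : HasFDerivAt f f' y)
    (hhom : ∀ c : ℝ, 0 < c → f (c • y) = c * f y) : f' y = f y := by
  have hline : HasDerivAt (fun c : ℝ => c • y) y 1 := by
    simpa using (hasDerivAt_id (1 : ℝ)).smul_const y
  have hcomp : HasDerivAt (fun c : ℝ => f (c • y)) (f' y) 1 :=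
    HasFDerivAt.comp_hasDerivAt (1 : ℝ) (by simpa using hf) hline
  have hmul : HasDerivAt (fun c : ℝ => c * f y) (f y) 1 := by
    simpa using (hasDerivAt_id (1 : ℝ)).mul_const (f y)
  refine hcomp.unique (hmul.congr_of_eventuallyEq ?_)
  filter_upwards [lt_mem_nhds one_pos] with c hc using hhom c hc

/-- the first variation of the Finsler length of a regular curve `γ` in the
tangential direction `A(t) = λ(t)·γ'(t)` vanishes (for `λ` vanishing at the endpoints).
Here `lam' t • γ' t + lam t • γ'' t` is the derivative `A'(t)`. -/
theorem first_variation_tangential_vanishes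
    (F : V2 → V2 → ℝ)
    (hFsmooth : ContDiffOn ℝ (⊤ : ℕ∞) (fun p : V2 × V2 => F p.1 p.2) {p : V2 × V2 | p.2 ≠ 0})
    (hhom : ∀ (x y : V2) (lam : ℝ), 0 < lam → F x (lam • y) = lam * F x y)
    (a b : ℝ) (hab : a < b)
    (γ γ' γ'' : ℝ → V2)
    (hγ : ∀ t ∈ Set.Icc a b, HasDerivAt γ (γ' t) t)
    (hγ' : ∀ t ∈ Set.Icc a b, HasDerivAt γ' (γ'' t) t)
    (hγ''cont : ContinuousOn γ'' (Set.Icc a b))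
    (hne : ∀ t ∈ Set.Icc a b, γ' t ≠ 0)
    (lam lam' : ℝ → ℝ)
    (hlam : ∀ t ∈ Set.Icc a b, HasDerivAt lam (lam' t) t)
    (hlam'cont : ContinuousOn lam' (Set.Icc a b))
    (hla : lam a = 0) (hlb : lam b = 0) :
    ∫ t in a..b,
        ((fderiv ℝ (fun x => F x (γ' t)) (γ t)) (lam t • γ' t)
          + (fderiv ℝ (F (γ t)) (γ' t)) (lam' t • γ' t + lam t • γ'' t)) = 0 := by
  set G : V2 × V2 → ℝ := fun p => F p.1 p.2
  have hopen : IsOpen {p : V2 × V2 | p.2 ≠ 0} := isOpen_ne_fun continuous_snd continuous_const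
  have hGdiff : ∀ p : V2 × V2, p.2 ≠ 0 → HasFDerivAt G (fderiv ℝ G p) p := fun p hp =>
    ((hFsmooth.contDiffAt (hopen.mem_nhds hp)).differentiableAt (by simp)).hasFDerivAt
  have hpartial₁ : ∀ t ∈ Set.Icc a b, HasFDerivAt (fun x => F x (γ' t))
      ((fderiv ℝ G (γ t, γ' t)).comp (ContinuousLinearMap.inl ℝ V2 V2)) (γ t) := fun t ht =>
    HasFDerivAt.comp (f := fun x => (x, γ' t)) (γ t) (hGdiff (γ t, γ' t) (hne t ht))
      (hasFDerivAt_prodMk_left (γ t) (γ' t))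
  have hpartial₂ : ∀ t ∈ Set.Icc a b, HasFDerivAt (F (γ t))
      ((fderiv ℝ G (γ t, γ' t)).comp (ContinuousLinearMap.inr ℝ V2 V2)) (γ' t) := fun t ht =>
    HasFDerivAt.comp (f := fun y => (γ t, y)) (γ' t) (hGdiff (γ t, γ' t) (hne t ht))
      (hasFDerivAt_prodMk_right (γ t) (γ' t))
  have hderiv : ∀ t ∈ Set.Icc a b, HasDerivAt (fun s => lam s * G (γ s, γ' s))
      (fderiv ℝ G (γ t, γ' t) (lam t • γ' t, lam' t • γ' t + lam t • γ'' t)) t := by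
    intro t ht
    have heuler : fderiv ℝ G (γ t, γ' t) (0, γ' t) = G (γ t, γ' t) := by
      simpa using (hpartial₂ t ht).apply_self_of_pos_homogeneous (hhom (γ t) (γ' t))
    have hcomp : HasDerivAt (fun s => G (γ s, γ' s))
        (fderiv ℝ G (γ t, γ' t) (γ' t, γ'' t)) t :=
      HasFDerivAt.comp_hasDerivAt (f := fun s => (γ s, γ' s)) t
        (hGdiff (γ t, γ' t) (hne t ht)) ((hγ t ht).prodMk (hγ' t ht))
    refine ((hlam t ht).mul hcomp).congr_deriv ?_
    have hsplit : (lam t • γ' t, lam' t • γ' t + lam t • γ'' t)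
        = lam' t • ((0 : V2), γ' t) + lam t • (γ' t, γ'' t) := by
      simp
    rw [hsplit, map_add, map_smul, map_smul, heuler, smul_eq_mul, smul_eq_mul]
  have hγ_cont : ContinuousOn γ (Set.Icc a b) := fun t ht =>
    (hγ t ht).continuousAt.continuousWithinAt
  have hγ'_cont : ContinuousOn γ' (Set.Icc a b) := fun t ht =>
    (hγ' t ht).continuousAt.continuousWithinAt
  have hlam_cont : ContinuousOn lam (Set.Icc a b) := fun t ht =>
    (hlam t ht).continuousAt.continuousWithinAt
  have hcont : ContinuousOn (fun t => fderiv ℝ G (γ t, γ' t)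
      (lam t • γ' t, lam' t • γ' t + lam t • γ'' t)) (Set.Icc a b) :=
    ((hFsmooth.continuousOn_fderiv_of_isOpen hopen (by simp)).comp
      (hγ_cont.prodMk hγ'_cont) hne).clm_apply
      ((hlam_cont.smul hγ'_cont).prodMk
        ((hlam'cont.smul hγ'_cont).add (hlam_cont.smul hγ''cont)))
  rw [← Set.uIcc_of_le hab.le] at hderiv hcont
  calc
    _ = ∫ t in a..b, fderiv ℝ G (γ t, γ' t)
        (lam t • γ' t, lam' t • γ' t + lam t • γ'' t) := by
      refine intervalIntegral.integral_congr fun t ht => ?_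
      rw [Set.uIcc_of_le hab.le] at ht
      simp only [(hpartial₁ t ht).fderiv, (hpartial₂ t ht).fderiv,
        ContinuousLinearMap.comp_apply, ContinuousLinearMap.inl_apply,
        ContinuousLinearMap.inr_apply]
      rw [← map_add, Prod.mk_add_mk, add_zero, zero_add]
    _ = 0 := by
      rw [intervalIntegral.integral_eq_sub_of_hasDerivAt hderiv hcont.intervalIntegrable,
        hla, hlb, zero_mul, zero_mul, sub_zero]
end
end

section
/- Let F be a Finsler metric on the 2-torus, v ∈ ℤ² a prime vector, and L̃ the associated time-periodic Lagrangian, and assume the Euler–Lagrange flow of L̃ is complete. Let b ∈ ℝ, and let w = r·v + h·v⊥ with r > 0 and F(b·v⊥, w) = 1. Let θ : ℝ → ℝ be the Euler–Lagrange solution of L̃ with θ(0) = b and θ'(0) = h/r, and set γ(t) = tv + θ(t)·v⊥. Let c : ℝ → ℝ² be a unit-speed F-geodesic with c(0) = b·v⊥ and c'(0) = w. Then there is a unique τ > 0 with ⟨c(τ), v⟩ = ‖v‖², and at this time c(τ) = v + θ(1)·v⊥ and c'(τ) = γ'(1)/F(γ(1), γ'(1)); i.e. the geodesic return map from the section {⟨x,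 v⟩ = 0} to the section {⟨x, v⟩ = ‖v‖²} is conjugated to the time-1 Euler–Lagrange map (θ(0), θ'(0)) ↦ (θ(1), θ'(1)) of L̃. -/
open Filter Topology

noncomputable section

/-- The derivative of a Finsler metric in the fibre direction. -/
def fiberDeriv (F : V2 → V2 → ℝ) (p : V2 × V2) : V2 →L[ℝ] ℝ := fderiv ℝ (F p.1) p.2

/-- The derivative of a Finsler metric in the base direction. -/
def baseDeriv (F : V2 → V2 → ℝ) (p : V2 × V2) : V2 →L[ℝ] ℝ := fderiv ℝ (fun x => F x p.2) p.1

namespace IsFinsler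

variable {F : V2 → V2 → ℝ}

theorem hasFDerivAt_uncurry (hF : IsFinsler F) {p : V2 × V2} (hp : p.2 ≠ 0) :
    HasFDerivAt (fun p : V2 × V2 => F p.1 p.2)
      (fderiv ℝ (fun p : V2 × V2 => F p.1 p.2) p) p :=
  ((hF.contDiffAt hp).differentiableAt (by simp)).hasFDerivAt

theorem hasFDerivAt_fiber (hF : IsFinsler F) {p : V2 × V2} (hp : p.2 ≠ 0) :
    HasFDerivAt (F p.1) ((fderiv ℝ (fun p : V2 × V2 => F p.1 p.2) p).comp
      (ContinuousLinearMap.inr ℝ V2 V2)) p.2 :=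
  (hF.hasFDerivAt_uncurry hp).comp (f := fun y => (p.1, y)) p.2 (hasFDerivAt_prodMk_right p.1 p.2)

theorem hasFDerivAt_base (hF : IsFinsler F) {p : V2 × V2} (hp : p.2 ≠ 0) :
    HasFDerivAt (fun x => F x p.2) ((fderiv ℝ (fun p : V2 × V2 => F p.1 p.2) p).comp
      (ContinuousLinearMap.inl ℝ V2 V2)) p.1 :=
  (hF.hasFDerivAt_uncurry hp).comp (f := fun x => (x, p.2)) p.1 (hasFDerivAt_prodMk_left p.1 p.2)

theorem fderiv_apply (hF : IsFinsler F) {p : V2 × V2} (hp : p.2 ≠ 0) (a : V2 × V2) :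
    fderiv ℝ (fun p : V2 × V2 => F p.1 p.2) p a = baseDeriv F p a.1 + fiberDeriv F p a.2 := by
  rw [baseDeriv, fiberDeriv, (hF.hasFDerivAt_base hp).fderiv, (hF.hasFDerivAt_fiber hp).fderiv]
  simp only [ContinuousLinearMap.comp_apply, ContinuousLinearMap.inl_apply,
    ContinuousLinearMap.inr_apply, ← map_add]
  simp

theorem hasFDerivAt_fiberDeriv (hF : IsFinsler F) {p : V2 × V2} (hp : p.2 ≠ 0) :
    HasFDerivAt (F p.1) (fiberDeriv F p) p.2 :=
  (hF.hasFDerivAt_fiber hp).differentiableAt.hasFDerivAt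

theorem hasFDerivAt_baseDeriv (hF : IsFinsler F) {p : V2 × V2} (hp : p.2 ≠ 0) :
    HasFDerivAt (fun x => F x p.2) (baseDeriv F p) p.1 :=
  (hF.hasFDerivAt_base hp).differentiableAt.hasFDerivAt

theorem fderiv_LF_fiber (hF : IsFinsler F) {p : V2 × V2} (hp : p.2 ≠ 0) :
    fderiv ℝ (LF F p.1) p.2 = F p.1 p.2 • fiberDeriv F p := by
  have h := ((hF.hasFDerivAt_fiberDeriv hp).pow 2).const_mul (1 / 2 : ℝ)
  refine (HasFDerivAt.fderiv (f := LF F p.1) h).trans ?_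
  ext <;> simp <;> ring

theorem fderiv_LF_base (hF : IsFinsler F) {p : V2 × V2} (hp : p.2 ≠ 0) :
    fderiv ℝ (fun x => LF F x p.2) p.1 = F p.1 p.2 • baseDeriv F p := by
  have h := ((hF.hasFDerivAt_baseDeriv hp).pow 2).const_mul (1 / 2 : ℝ)
  refine (HasFDerivAt.fderiv (f := fun x => LF F x p.2) h).trans ?_
  ext <;> simp <;> ring

theorem contDiffAt_fderiv (hF : IsFinsler F) {p : V2 × V2} (hp : p.2 ≠ 0) :
    ContDiffAt ℝ 1 (fderiv ℝ (fun p : V2 × V2 => F p.1 p.2)) p :=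
  (hF.contDiffAt hp).fderiv_right (by norm_cast)

theorem contDiffAt_fiberDeriv (hF : IsFinsler F) {p : V2 × V2} (hp : p.2 ≠ 0) :
    ContDiffAt ℝ 1 (fiberDeriv F) p := by
  refine ((hF.contDiffAt_fderiv hp).clm_comp
    (contDiffAt_const (c := ContinuousLinearMap.inr ℝ V2 V2))).congr_of_eventuallyEq ?_
  filter_upwards [isOpen_snd_ne_zero.mem_nhds hp] with q hq
  exact (hF.hasFDerivAt_fiber hq).fderiv

theorem contDiffAt_baseDeriv (hF : IsFinsler F) {p : V2 × V2} (hp : p.2 ≠ 0) :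
    ContDiffAt ℝ 1 (baseDeriv F) p := by
  refine ((hF.contDiffAt_fderiv hp).clm_comp
    (contDiffAt_const (c := ContinuousLinearMap.inl ℝ V2 V2))).congr_of_eventuallyEq ?_
  filter_upwards [isOpen_snd_ne_zero.mem_nhds hp] with q hq
  exact (hF.hasFDerivAt_base hq).fderiv

/-- The Legendre map `(x, y) ↦ (x, ∂_y L_F(x, y))` is locally anti-Lipschitz. -/
theorem eventually_legendre_antilipschitz (hF : IsFinsler F) {p : V2 × V2} (hp : p.2 ≠ 0) :
    ∃ K > 0, ∀ᶠ z : (V2 × V2) × (V2 × V2) in 𝓝 (p, p),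
      ‖z.1 - z.2‖ ≤ K * ‖(z.1.1 - z.2.1,
        F z.1.1 z.1.2 • fiberDeriv F z.1 - F z.2.1 z.2.2 • fiberDeriv F z.2)‖ := by
  set Φ : V2 × V2 → V2 →L[ℝ] ℝ := fun q => F q.1 q.2 • fiberDeriv F q
  have hΦd : ContDiffAt ℝ 1 Φ p :=
    ((hF.contDiffAt hp).of_le (by norm_cast)).smul (hF.contDiffAt_fiberDeriv hp)
  have hΨd : HasStrictFDerivAt (fun q : V2 × V2 => (q.1, Φ q))
      ((ContinuousLinearMap.fst ℝ V2 V2).prod (fderiv ℝ Φ p)) p :=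
    hasStrictFDerivAt_fst.prodMk (hΦd.hasStrictFDerivAt one_ne_zero)
  have hinj : Function.Injective ((ContinuousLinearMap.fst ℝ V2 V2).prod (fderiv ℝ Φ p)) := by
    rw [injective_iff_map_eq_zero]
    rintro ⟨a, w⟩ h
    simp only [ContinuousLinearMap.prod_apply, Prod.mk_eq_zero, ContinuousLinearMap.coe_fst'] at h
    obtain ⟨rfl, h⟩ := h
    by_contra hw
    have hw : w ≠ 0 := by simpa using hw
    have h1 : HasFDerivAt (fderiv ℝ (LF F p.1))
        ((fderiv ℝ Φ p).comp (ContinuousLinearMap.inr ℝ V2 V2)) p.2 := by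
      refine HasFDerivAt.congr_of_eventuallyEq
        ((hΦd.differentiableAt one_ne_zero).hasFDerivAt.comp (f := fun y => (p.1, y)) p.2
          (hasFDerivAt_prodMk_right p.1 p.2)) ?_
      filter_upwards [isOpen_ne.mem_nhds hp] with y hy
      exact hF.fderiv_LF_fiber (p := (p.1, y)) hy
    have h2 := hF.2.2.2.2 p.1 p.2 hp w hw
    rw [h1.fderiv] at h2
    simp [h] at h2
  obtain ⟨C, hC, hanti⟩ := ((ContinuousLinearMap.fst ℝ V2 V2).prod
    (fderiv ℝ Φ p)).toLinearMap.exists_antilipschitzWith (LinearMap.ker_eq_bot.2 hinj)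
  have hlit := hΨd.isLittleO.def (c := (2 * C : ℝ)⁻¹) (by positivity)
  refine ⟨2 * C, by positivity, ?_⟩
  filter_upwards [hlit] with z hz
  have h1 := hanti.le_mul_dist (z.1 - z.2) 0
  simp only [dist_zero_right, map_zero] at h1
  set A := ((ContinuousLinearMap.fst ℝ V2 V2).prod (fderiv ℝ Φ p)) (z.1 - z.2)
  change ‖z.1 - z.2‖ ≤ C * ‖A‖ at h1
  change _ ≤ _ * ‖(z.1.1, Φ z.1) - (z.2.1, Φ z.2)‖
  set B := ((z.1.1, Φ z.1) - (z.2.1, Φ z.2) : V2 × (V2 →L[ℝ] ℝ))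
  change ‖B - A‖ ≤ _ at hz
  have hC' : (0 : ℝ) < C := hC
  have h2 : ‖A‖ ≤ ‖B‖ + ‖B - A‖ := by
    have := norm_sub_le B (B - A)
    simpa using this
  have h3 : C * ((2 * C : ℝ)⁻¹ * ‖z.1 - z.2‖) = ‖z.1 - z.2‖ / 2 := by
    field_simp
  have h4 : C * ‖A‖ ≤ C * (‖B‖ + (2 * C : ℝ)⁻¹ * ‖z.1 - z.2‖) := by gcongr; linarith
  linarith

/-- Two extremals of the length functional with a common speed and the same initial velocity
agree for all positive times. -/
theorem extremal_unique (hF : IsFinsler F) {α β α' β' : ℝ → V2} {σ : ℝ → ℝ}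
    (hσ : Continuous σ)
    (hα : ∀ t, HasDerivAt α (α' t) t) (hα' : Continuous α') (hα0 : ∀ t, α' t ≠ 0)
    (hασ : ∀ t, F (α t) (α' t) = σ t)
    (hαE : ∀ t, HasDerivAt (fun s => fiberDeriv F (α s, α' s)) (baseDeriv F (α t, α' t)) t)
    (hβ : ∀ t, HasDerivAt β (β' t) t) (hβ' : Continuous β')
    (hβσ : ∀ t, F (β t) (β' t) = σ t)
    (hβE : ∀ t, HasDerivAt (fun s => fiberDeriv F (β s, β' s)) (baseDeriv F (β t, β' t)) t)
    (h0 : α 0 = β 0) (h0' : α' 0 = β' 0) {t : ℝ} (ht : 0 ≤ t) :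
    α t = β t ∧ α' t = β' t := by
  have hαc : Continuous α := continuous_iff_continuousAt.2 fun t => (hα t).continuousAt
  have hβc : Continuous β := continuous_iff_continuousAt.2 fun t => (hβ t).continuousAt
  set S : Set ℝ := {t | α t = β t ∧ α' t = β' t}
  have hSc : IsClosed S := (isClosed_eq hαc hβc).inter (isClosed_eq hα' hβ')
  have key : Set.Icc 0 t ⊆ S := by
    refine (hSc.inter isClosed_Icc).Icc_subset_of_forall_mem_nhdsWithin ⟨h0, h0'⟩ ?_
    rintro x ⟨⟨hx, hx'⟩, -⟩
    have hp : ((α x, α' x) : V2 × V2).2 ≠ 0 := hα0 x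
    obtain ⟨K, hK, hanti⟩ := hF.eventually_legendre_antilipschitz hp
    obtain ⟨M, hM, hlip⟩ := ((hF.contDiffAt_baseDeriv hp).hasStrictFDerivAt
      one_ne_zero).isBigO_sub.exists_pos
    have hlip := hlip.bound
    have htend : Tendsto (fun s => ((α s, α' s), (β s, β' s))) (𝓝 x)
        (𝓝 ((α x, α' x), (α x, α' x))) := by
      have h : Continuous fun s => (((α s, α' s), (β s, β' s)) : (V2 × V2) × (V2 × V2)) := by
        fun_prop
      have h := h.tendsto x
      rwa [← hx, ← hx'] at h
    have hσb : ∀ᶠ s in 𝓝 x, |σ s| < |σ x| + 1 :=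
      hσ.abs.continuousAt.eventually (gt_mem_nhds (by linarith))
    set q := fun s => fiberDeriv F (α s, α' s) - fiberDeriv F (β s, β' s) with hq
    set u := fun s => ((α s - β s, q s) : V2 × (V2 →L[ℝ] ℝ)) with hu
    set u' := fun s => ((α' s - β' s, baseDeriv F (α s, α' s) - baseDeriv F (β s, β' s)) :
      V2 × (V2 →L[ℝ] ℝ))
    have hud : ∀ s, HasDerivAt u (u' s) s := fun s =>
      ((hα s).sub (hβ s)).prodMk ((hαE s).sub (hβE s))
    set C := K * (|σ x| + 1) with hC
    have hbase : ∀ᶠ s in 𝓝 x, ‖((α s, α' s) : V2 × V2) - (β s, β' s)‖ ≤ C * ‖u s‖ := by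
      filter_upwards [htend.eventually hanti, hσb] with s hs hsσ
      refine hs.trans ?_
      rw [hC, mul_assoc]
      gcongr
      simp only [hασ, hβσ]
      have e1 : ‖α s - β s‖ ≤ ‖u s‖ := norm_fst_le (u s)
      have e2 : ‖q s‖ ≤ ‖u s‖ := norm_snd_le (u s)
      rw [Prod.norm_def]
      refine max_le ?_ ?_
      · have := norm_nonneg (u s)
        have := abs_nonneg (σ x)
        change ‖α s - β s‖ ≤ _
        nlinarith
      · have e3 : σ s • fiberDeriv F (α s, α' s) - σ s • fiberDeriv F (β s, β' s) = σ s • q s :=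
          (smul_sub _ _ _).symm
        change ‖σ s • fiberDeriv F (α s, α' s) - σ s • fiberDeriv F (β s, β' s)‖ ≤ _
        rw [e3, norm_smul, Real.norm_eq_abs]
        gcongr
    have hbound : ∀ᶠ s in 𝓝 x, ‖u' s‖ ≤ max C (M * C) * ‖u s‖ := by
      filter_upwards [hbase, htend.eventually hlip] with s h1 h2
      rw [Prod.norm_def]
      refine max_le ?_ ?_
      · calc ‖α' s - β' s‖ ≤ ‖((α s, α' s) : V2 × V2) - (β s, β' s)‖ :=
              norm_snd_le (((α s, α' s) : V2 × V2) - (β s, β' s))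
          _ ≤ C * ‖u s‖ := h1
          _ ≤ _ := by gcongr; exact le_max_left _ _
      · calc ‖baseDeriv F (α s, α' s) - baseDeriv F (β s, β' s)‖
            ≤ M * ‖((α s, α' s) : V2 × V2) - (β s, β' s)‖ := h2
          _ ≤ M * (C * ‖u s‖) := by gcongr
          _ = M * C * ‖u s‖ := by ring
          _ ≤ _ := by gcongr; exact le_max_right _ _
    obtain ⟨ε, hε, hball⟩ := Metric.eventually_nhds_iff.1 (hbound.and hbase)
    have hzero : ∀ s ∈ Set.Icc x (x + ε / 2), u s = 0 := by
      refine eq_zero_of_abs_deriv_le_mul_abs_self_of_eq_zero_right (f' := u')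
        (K := max C (M * C))
        (fun s _ => (hud s).continuousAt.continuousWithinAt)
        (fun s _ => (hud s).hasDerivWithinAt) (by simp [hu, hq, hx, hx']) ?_
      intro s hs
      refine (hball ?_).1
      rw [Real.dist_eq, abs_lt]
      constructor <;> linarith [hs.1, hs.2]
    filter_upwards [Ioo_mem_nhdsGT (show x < x + ε / 2 by linarith)] with s hs
    have h1 := (@hball s (by rw [Real.dist_eq, abs_lt]; constructor <;> linarith [hs.1, hs.2])).2
    rw [hzero s ⟨hs.1.le, hs.2.le⟩, norm_zero, mul_zero] at h1
    have h2 := sub_eq_zero.1 (norm_le_zero_iff.1 h1)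
    exact Prod.mk.inj h2
  exact key ⟨ht, le_rfl⟩

theorem fiberDeriv_smul (hF : IsFinsler F) {x y : V2} (hy : y ≠ 0) {l : ℝ} (hl : 0 < l) :
    fiberDeriv F (x, l • y) = fiberDeriv F (x, y) := by
  have h1 := (hF.hasFDerivAt_fiberDeriv (p := (x, l • y)) (smul_ne_zero hl.ne' hy)).comp y
    ((hasFDerivAt_id y).const_smul l)
  have h2 : HasFDerivAt (fun z => l * F x z) (l • fiberDeriv F (x, y)) y :=
    (hF.hasFDerivAt_fiberDeriv (p := (x, y)) hy).const_mul l
  have h3 : (F x ∘ fun z => l • z) = fun z => l * F x z := funext fun z => hF.2.2.1 x z l hl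
  have h4 := h1.unique (h3 ▸ h2)
  refine ContinuousLinearMap.ext fun z => ?_
  have h5 := DFunLike.congr_fun h4 z
  have h6 : l * fiberDeriv F (x, l • y) z = l * fiberDeriv F (x, y) z := by simpa using h5
  exact mul_left_cancel₀ hl.ne' h6

theorem baseDeriv_smul (hF : IsFinsler F) {x y : V2} (hy : y ≠ 0) {l : ℝ} (hl : 0 < l) :
    baseDeriv F (x, l • y) = l • baseDeriv F (x, y) := by
  have h := (hF.hasFDerivAt_baseDeriv (p := (x, y)) hy).const_mul l
  simpa only [baseDeriv, hF.2.2.1 _ _ _ hl] using h.fderiv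

/-- The Euler identity for homogeneous functions. -/
theorem fiberDeriv_apply_self (hF : IsFinsler F) {p : V2 × V2} (hp : p.2 ≠ 0) :
    fiberDeriv F p p.2 = F p.1 p.2 := by
  have h1 : HasDerivAt (fun l : ℝ => l • p.2) p.2 1 := by
    simpa using (hasDerivAt_id (1 : ℝ)).smul_const p.2
  have h2 : HasDerivAt (fun l : ℝ => F p.1 (l • p.2)) (fiberDeriv F p p.2) 1 :=
    HasFDerivAt.comp_hasDerivAt (l := F p.1) (1 : ℝ) (by
      simpa using hF.hasFDerivAt_fiberDeriv hp) h1
  have h3 : HasDerivAt (fun l : ℝ => l * F p.1 p.2) (F p.1 p.2) 1 := by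
    simpa using (hasDerivAt_id (1 : ℝ)).mul_const (F p.1 p.2)
  refine h2.unique (h3.congr_of_eventuallyEq ?_)
  filter_upwards [lt_mem_nhds (zero_lt_one' ℝ)] with l hl
  exact hF.2.2.1 _ _ _ hl

end IsFinsler

theorem normSq_pos_of_isCoprime {v : ℤ × ℤ} (hv : IsCoprime v.1 v.2) :
    0 < (v.1 : ℝ) ^ 2 + (v.2 : ℝ) ^ 2 := by
  have h : v.1 ≠ 0 ∨ v.2 ≠ 0 := by
    by_contra! h
    rw [h.1, h.2] at hv
    exact not_isCoprime_zero_zero hv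
  rcases h with h | h
  · have : (v.1 : ℝ) ≠ 0 := by exact_mod_cast h
    positivity
  · have : (v.2 : ℝ) ≠ 0 := by exact_mod_cast h
    positivity

theorem dot_smul_vR_add_smul_vPerp (v : ℤ × ℤ) (a b : ℝ) :
    dot (a • vR v + b • vPerp v) (vR v) = a * ((v.1 : ℝ) ^ 2 + (v.2 : ℝ) ^ 2) := by
  simp [dot, vR, vPerp]
  ring

theorem continuous_dot_vR (v : ℤ × ℤ) : Continuous fun x : V2 => dot x (vR v) := by
  unfold dot
  fun_prop

theorem vR_add_smul_vPerp_ne_zero {v : ℤ × ℤ} (hv : 0 < (v.1 : ℝ) ^ 2 + (v.2 : ℝ) ^ 2) (a : ℝ) :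
    vR v + a • vPerp v ≠ 0 := by
  intro h
  have h1 := dot_smul_vR_add_smul_vPerp v 1 a
  rw [one_smul, h, one_mul] at h1
  simp [dot] at h1
  linarith

/-- Derivatives of functional-valued curves can be checked on the basis `v, v⊥`. -/
theorem hasDerivAt_of_apply_vR_vPerp {v : ℤ × ℤ} (hv : 0 < (v.1 : ℝ) ^ 2 + (v.2 : ℝ) ^ 2)
    {A : ℝ → V2 →L[ℝ] ℝ} {A' : V2 →L[ℝ] ℝ} {t : ℝ}
    (h1 : HasDerivAt (fun s => A s (vR v)) (A' (vR v)) t)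
    (h2 : HasDerivAt (fun s => A s (vPerp v)) (A' (vPerp v)) t) : HasDerivAt A A' t := by
  set N := (v.1 : ℝ) ^ 2 + (v.2 : ℝ) ^ 2 with hN
  set e₁ : V2 →L[ℝ] ℝ := N⁻¹ • ((v.1 : ℝ) • ContinuousLinearMap.fst ℝ ℝ ℝ +
    (v.2 : ℝ) • ContinuousLinearMap.snd ℝ ℝ ℝ) with he₁
  set e₂ : V2 →L[ℝ] ℝ := N⁻¹ • (-(v.2 : ℝ) • ContinuousLinearMap.fst ℝ ℝ ℝ +
    (v.1 : ℝ) • ContinuousLinearMap.snd ℝ ℝ ℝ) with he₂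
  have hdec : ∀ B : V2 →L[ℝ] ℝ, B (vR v) • e₁ + B (vPerp v) • e₂ = B := by
    intro B
    refine ContinuousLinearMap.ext fun z => ?_
    have hz : z = e₁ z • vR v + e₂ z • vPerp v := by
      refine Prod.ext ?_ ?_ <;> simp [he₁, he₂, vR, vPerp] <;> field_simp <;> rw [hN] <;> ring
    conv_rhs => rw [hz]
    simp [mul_comm]
  have h3 := (h1.smul_const e₁).add (h2.smul_const e₂)
  rw [hdec] at h3
  exact h3.congr_of_eventuallyEq (Eventually.of_forall fun s => (hdec (A s)).symm)

namespace IsELSolution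

variable {F : V2 → V2 → ℝ} {v : ℤ × ℤ} {θ : ℝ → ℝ}

theorem hasDerivAt (hθ : IsELSolution (Ltilde F v) θ) (t : ℝ) : HasDerivAt θ (deriv θ t) t :=
  (hθ.1.differentiable (by norm_num) t).hasDerivAt

theorem hasDerivAt_deriv (hθ : IsELSolution (Ltilde F v) θ) (t : ℝ) :
    HasDerivAt (deriv θ) (deriv (deriv θ) t) t := by
  have h : ContDiff ℝ 1 (deriv θ) := ((contDiff_succ_iff_deriv (n := 1)).1 hθ.1).2.2
  exact (h.differentiable one_ne_zero t).hasDerivAt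

theorem hasDerivAt_graph (hθ : IsELSolution (Ltilde F v) θ) (t : ℝ) :
    HasDerivAt (fun s => s • vR v + θ s • vPerp v) (vR v + deriv θ t • vPerp v) t := by
  have h := ((hasDerivAt_id t).smul_const (vR v)).add ((hθ.hasDerivAt t).smul_const (vPerp v))
  rw [one_smul] at h
  exact h

/-- The graph `t ↦ t v + θ(t) v⊥` of an Euler–Lagrange solution of `L̃` is an extremal of the
length functional of `F`. -/
theorem hasDerivAt_fiberDeriv (hθ : IsELSolution (Ltilde F v) θ) (hF : IsFinsler F)
    (hv : 0 < (v.1 : ℝ) ^ 2 + (v.2 : ℝ) ^ 2) (t : ℝ) :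
    HasDerivAt (fun s => fiberDeriv F (s • vR v + θ s • vPerp v, vR v + deriv θ s • vPerp v))
      (baseDeriv F (t • vR v + θ t • vPerp v, vR v + deriv θ t • vPerp v)) t := by
  set γ := fun s => s • vR v + θ s • vPerp v with hγ
  set γ' := fun s => vR v + deriv θ s • vPerp v with hγ'
  have hne : ∀ s, γ' s ≠ 0 := fun s => vR_add_smul_vPerp_ne_zero hv _
  have hP : HasDerivAt (fun s => fiberDeriv F (γ s, γ' s) (vPerp v))
      (baseDeriv F (γ t, γ' t) (vPerp v)) t := by
    have h := hθ.2 t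
    have hx : deriv (fun x => Ltilde F v t x (deriv θ t)) (θ t) =
        baseDeriv F (γ t, γ' t) (vPerp v) := by
      have h1 : HasDerivAt (fun x : ℝ => t • vR v + x • vPerp v) (vPerp v) (θ t) := by
        simpa using ((hasDerivAt_id (θ t)).smul_const (vPerp v)).const_add (t • vR v)
      exact (HasFDerivAt.comp_hasDerivAt (l := fun x => F x (γ' t)) (θ t)
        (hF.hasFDerivAt_baseDeriv (p := (γ t, γ' t)) (hne t)) h1).deriv
    have hr : ∀ s, deriv (fun r => Ltilde F v s (θ s) r) (deriv θ s) =
        fiberDeriv F (γ s, γ' s) (vPerp v) := by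
      intro s
      have h1 : HasDerivAt (fun r : ℝ => vR v + r • vPerp v) (vPerp v) (deriv θ s) := by
        simpa using ((hasDerivAt_id (deriv θ s)).smul_const (vPerp v)).const_add (vR v)
      exact (HasFDerivAt.comp_hasDerivAt (l := F (γ s)) (deriv θ s)
        (hF.hasFDerivAt_fiberDeriv (p := (γ s, γ' s)) (hne s)) h1).deriv
    rw [hx] at h
    exact h.congr_of_eventuallyEq (Eventually.of_forall fun s => (hr s).symm)
  refine hasDerivAt_of_apply_vR_vPerp hv ?_ hP
  have hγ'd : HasDerivAt γ' (deriv (deriv θ) t • vPerp v) t := by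
    exact ((hθ.hasDerivAt_deriv t).smul_const (vPerp v)).const_add (vR v)
  have hE : HasDerivAt (fun s => F (γ s) (γ' s)) (baseDeriv F (γ t, γ' t) (γ' t) +
      fiberDeriv F (γ t, γ' t) (deriv (deriv θ) t • vPerp v)) t := by
    have h := HasFDerivAt.comp_hasDerivAt (l := fun p : V2 × V2 => F p.1 p.2) t
      (hF.hasFDerivAt_uncurry (p := (γ t, γ' t)) (hne t)) ((hθ.hasDerivAt_graph t).prodMk hγ'd)
    rw [hF.fderiv_apply (hne t)] at h
    exact h
  have hV : ∀ s, fiberDeriv F (γ s, γ' s) (vR v) =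
      F (γ s) (γ' s) - deriv θ s * fiberDeriv F (γ s, γ' s) (vPerp v) := by
    intro s
    rw [← hF.fiberDeriv_apply_self (p := (γ s, γ' s)) (hne s)]
    simp [hγ']
  have h := hE.sub ((hθ.hasDerivAt_deriv t).mul hP)
  refine (h.congr_of_eventuallyEq (Eventually.of_forall hV)).congr_deriv ?_
  simp only [hγ', map_add, map_smul, smul_eq_mul]
  ring

end IsELSolution

/-- A unit-speed geodesic, reparametrized with positive speed, is an extremal of the length
functional. -/
theorem IsGeodesic.hasDerivAt_fiberDeriv_comp {F : V2 → V2 → ℝ} {c : ℝ → V2}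
    (hc : IsGeodesic F c) (hF : IsFinsler F) (hcu : IsUnitSpeed F c) {s σ : ℝ → ℝ}
    (hs : ∀ t, HasDerivAt s (σ t) t) (hσ : ∀ t, 0 < σ t) (t : ℝ) :
    HasDerivAt (fun x => fiberDeriv F (c (s x), σ x • deriv c (s x)))
      (baseDeriv F (c (s t), σ t • deriv c (s t))) t := by
  have h1 : ∀ x, fderiv ℝ (LF F (c x)) (deriv c x) = fiberDeriv F (c x, deriv c x) := by
    intro x
    rw [hF.fderiv_LF_fiber (p := (c x, deriv c x)) (hc.2.1 x)]
    simp [hcu x]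
  have h2 := hc.2.2 (s t)
  rw [hF.fderiv_LF_base (p := (c (s t), deriv c (s t))) (hc.2.1 _)] at h2
  simp only [h1, hcu (s t), one_smul] at h2
  rw [hF.baseDeriv_smul (hc.2.1 _) (hσ t)]
  refine (h2.scomp t (hs t)).congr_of_eventuallyEq (Eventually.of_forall fun x => ?_)
  exact hF.fiberDeriv_smul (hc.2.1 _) (hσ x)

/-- the geodesic return map from the section `⟨x,v⟩ = 0` to `⟨x,v⟩ = ‖v‖²`
is conjugated to the time-1 Euler–Lagrange map of `L̃`: the geodesic starting at `b·v⊥`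
with unit velocity `w = r·v + h·v⊥` first hits the second section at the point
`v + θ(1)·v⊥` with direction `γ'(1)/F(γ(1), γ'(1))`, where `θ` is the EL-solution with
`θ(0) = b`, `θ'(0) = h/r` and `γ(t) = tv + θ(t)v⊥`. -/
theorem return_map_conjugated_to_time_one_map
    (F : V2 → V2 → ℝ) (hF : IsFinsler F)
    (v : ℤ × ℤ) (hv : IsCoprime v.1 v.2)
    (hcomp : ELComplete (Ltilde F v))
    (b r h : ℝ) (hr : 0 < r) (w : V2) (hw : w = r • vR v + h • vPerp v)
    (hunit : F (b • vPerp v) w = 1)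
    (θ : ℝ → ℝ) (hθ : IsELSolution (Ltilde F v) θ)
    (hθ0 : θ 0 = b) (hθ'0 : deriv θ 0 = h / r)
    (c : ℝ → V2) (hc : IsGeodesic F c) (hcu : IsUnitSpeed F c)
    (hc0 : c 0 = b • vPerp v) (hc'0 : deriv c 0 = w) :
    ∃ τ : ℝ, 0 < τ ∧ dot (c τ) (vR v) = (v.1 : ℝ)^2 + (v.2 : ℝ)^2 ∧
      (∀ τ' : ℝ, 0 < τ' → dot (c τ') (vR v) = (v.1 : ℝ)^2 + (v.2 : ℝ)^2 → τ' = τ) ∧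
      c τ = vR v + θ 1 • vPerp v ∧
      deriv c τ = (F (vR v + θ 1 • vPerp v) (vR v + deriv θ 1 • vPerp v))⁻¹ •
        (vR v + deriv θ 1 • vPerp v) := by
  have hN := normSq_pos_of_isCoprime hv
  set γ := fun s => s • vR v + θ s • vPerp v with hγ
  set γ' := fun s => vR v + deriv θ s • vPerp v with hγ'
  set σ := fun s => F (γ s) (γ' s) with hσdef
  have hne : ∀ s, γ' s ≠ 0 := fun s => vR_add_smul_vPerp_ne_zero hN _
  have hγ'c : Continuous γ' := by
    have : Continuous (deriv θ) :=
      continuous_iff_continuousAt.2 fun t => (hθ.hasDerivAt_deriv t).continuousAt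
    fun_prop
  have hσ : Continuous σ := by
    refine continuous_iff_continuousAt.2 fun t => ?_
    exact ContinuousAt.comp (g := fun p : V2 × V2 => F p.1 p.2) (f := fun t => (γ t, γ' t))
      (hF.hasFDerivAt_uncurry (p := (γ t, γ' t)) (hne t)).continuousAt
      ((hθ.hasDerivAt_graph t).continuousAt.prodMk hγ'c.continuousAt)
  have hσpos : ∀ t, 0 < σ t := fun t => hF.2.2.2.1 _ _ (hne t)
  set s := fun t => ∫ x in (0 : ℝ)..t, σ x
  have hs : ∀ t, HasDerivAt s (σ t) t := fun t =>
    intervalIntegral.integral_hasDerivAt_right (hσ.intervalIntegrable _ _)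
      (hσ.stronglyMeasurableAtFilter _ _) hσ.continuousAt
  have hs0 : s 0 = 0 := intervalIntegral.integral_same
  have hsc : Continuous s := continuous_iff_continuousAt.2 fun t => (hs t).continuousAt
  have hmono : StrictMono s := strictMono_of_deriv_pos fun t => by
    rw [(hs t).deriv]; exact hσpos t
  have hcd : ∀ t, HasDerivAt c (deriv c t) t := fun t =>
    (hc.1.differentiable (by norm_num) t).hasDerivAt
  have hcc : Continuous (deriv c) := hc.1.continuous_deriv (by norm_num)
  have hw' : w = r • γ' 0 := by
    rw [hw, hγ']
    simp only [hθ'0, smul_add, smul_smul, mul_div_cancel₀ h hr.ne']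
  have hγ0 : γ 0 = b • vPerp v := by simp [hγ, hθ0]
  have hσ0 : σ 0 * r = 1 := by
    rw [← hunit, hw', hF.2.2.1 _ _ _ hr, hσdef, ← hγ0, mul_comm]
  have heq : ∀ t, 0 ≤ t → γ t = c (s t) ∧ γ' t = σ t • deriv c (s t) := fun t ht =>
    hF.extremal_unique (σ := σ) (β := fun x => c (s x)) (β' := fun x => σ x • deriv c (s x)) hσ
      hθ.hasDerivAt_graph hγ'c hne (fun _ => rfl) (hθ.hasDerivAt_fiberDeriv hF hN)
      (fun t => (hcd (s t)).scomp t (hs t)) (by fun_prop)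
      (fun t => by rw [hF.2.2.1 _ _ _ (hσpos t), hcu, mul_one])
      (hc.hasDerivAt_fiberDeriv_comp hF hcu hs hσpos)
      (by rw [hs0, hc0]; exact hγ0) (by rw [hs0, hc'0, hw', smul_smul, hσ0, one_smul]) ht
  have hdot : ∀ t, 0 ≤ t →
      dot (c (s t)) (vR v) = t * ((v.1 : ℝ) ^ 2 + (v.2 : ℝ) ^ 2) := fun t ht => by
    rw [← (heq t ht).1, hγ, dot_smul_vR_add_smul_vPerp]
  refine ⟨s 1, ?_, ?_, ?_, ?_, ?_⟩
  · rw [← hs0]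
    exact hmono one_pos
  · rw [hdot 1 zero_le_one, one_mul]
  · intro τ' hτ' hdτ'
    obtain ⟨T, hT0, hT⟩ : ∃ T, 0 ≤ T ∧ τ' ≤ s T := by
      obtain ⟨M, hM⟩ := (isCompact_Icc (a := (0 : ℝ)) (b := τ')).bddAbove_image
        ((continuous_dot_vR v).comp hc.1.continuous).continuousOn
      set T := (|M| + 1) / ((v.1 : ℝ) ^ 2 + (v.2 : ℝ) ^ 2) with hTdef
      have hT0 : 0 ≤ T := by positivity
      refine ⟨T, hT0, ?_⟩
      by_contra! hlt
      have h1 : dot (c (s T)) (vR v) ≤ M :=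
        hM ⟨s T, ⟨hs0.symm.trans_le (hmono.monotone hT0), hlt.le⟩, rfl⟩
      rw [hdot T hT0, hTdef, div_mul_cancel₀ _ hN.ne'] at h1
      linarith [le_abs_self M]
    obtain ⟨t, ht, rfl⟩ := intermediate_value_Icc hT0 hsc.continuousOn
      (show τ' ∈ Set.Icc (s 0) (s T) from ⟨hs0.trans_le hτ'.le, hT⟩)
    rw [hdot t ht.1] at hdτ'
    rw [mul_right_cancel₀ hN.ne' (hdτ'.trans (one_mul _).symm)]
  · rw [← (heq 1 zero_le_one).1]
    simp [hγ]
  · have h1 : F (vR v + θ 1 • vPerp v) (vR v + deriv θ 1 • vPerp v) = σ 1 := by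
      simp [hσdef, hγ, hγ']
    rw [h1]
    change _ = (σ 1)⁻¹ • γ' 1
    rw [(heq 1 zero_le_one).2, smul_smul, inv_mul_cancel₀ (hσpos 1).ne', one_smul]
end
end
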